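/- arXiv:1801.10136 — 2 statements merged into one kernel-verified Lean document; each statement's English description precedes it below -/
import Mathlib

section
/- Let (f_n) be a sequence of functions f_n : ℕ∞ → ℕ such that for every x ∈ ℕ∞ the sequence (f_n(x)) converges to 0, and suppose there exist a sequence (α_n) in ℕ∞ and a sequence (k_n) of natural numbers such that for every n: k_n ≥ n, α_n ≥ n̲, and f_{k_n}(α_n) ≠ 0. Then LPO holds. -/
/-- `ℕ∞`: the set of increasing binary sequences. -/
def NInf : Type := {α : ℕ → Bool // ∀ n, α n = true → α (n + 1) = true}

/-- `n̲ ∈ ℕ∞`: `n` zeros followed by all ones. -/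
def NInf.underline (n : ℕ) : NInf :=
  ⟨fun k => decide (n ≤ k), by
    intro k h
    simp only [decide_eq_true_eq] at *
    omega⟩

/-- The limited principle of omniscience. -/
def LPO : Prop := ∀ a : ℕ → Bool, (∀ n, a n = false) ∨ (∃ n, a n = true)

/-- The point of `ℕ∞` that agrees with `a m` if `m` is the first index with `b m = true`,
and is constantly `false` if `b` is. Its `n`-th term only inspects `b` up to `n`. -/
def NInf.glue (a : ℕ → NInf) (b : ℕ → Bool) : NInf :=
  ⟨fun n => decide (∃ m, m < n + 1 ∧ b m = true ∧ (∀ j < m, b j = false) ∧ (a m).1 n = true), by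
    intro n h
    obtain ⟨m, hm, hb, hmin, ha⟩ := of_decide_eq_true h
    exact decide_eq_true ⟨m, Nat.lt_succ_of_lt hm, hb, hmin, (a m).2 n ha⟩⟩

theorem NInf.glue_eq {a : ℕ → NInf} (ha : ∀ n, ∀ j < n, (a n).1 j = false) {b : ℕ → Bool} {m : ℕ}
    (hb : b m = true) (hmin : ∀ j < m, b j = false) : NInf.glue a b = a m := by
  refine Subtype.ext (funext fun n => Bool.eq_iff_iff.mpr ⟨fun h => ?_, fun h => ?_⟩)
  · obtain ⟨i, -, hbi, hi, hai⟩ := of_decide_eq_true h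
    rcases Nat.lt_trichotomy i m with him | rfl | hmi
    · exact Bool.noConfusion (hbi.symm.trans (hmin i him))
    · exact hai
    · exact Bool.noConfusion (hb.symm.trans (hi m hmi))
  · refine decide_eq_true ⟨m, Nat.lt_of_not_le fun hnm => ?_, hb, hmin, h⟩
    exact Bool.noConfusion (h.symm.trans (ha m n hnm))

/-- A binary sequence taking the value `true` at `n` does so for a first time. -/
theorem exists_first_true {b : ℕ → Bool} (n : ℕ) (hn : b n = true) :
    ∃ m, b m = true ∧ ∀ j < m, b j = false := by
  induction n using Nat.strongRecOn with
  | ind n ih =>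
    rcases Decidable.em (∃ j, j < n ∧ b j = true) with ⟨j, hj, hbj⟩ | h
    · exact ih j hj hbj
    · exact ⟨n, hn, fun j hj => Bool.eq_false_of_not_eq_true fun hbj => h ⟨j, hj, hbj⟩⟩

/-- If a sequence of functions `ℕ∞ → ℕ` converges pointwise to 0 but there is a
witness that the convergence is not uniform, then LPO holds. -/
theorem third_trick_NInf_second_case_LPO (f : ℕ → NInf → ℕ)
    (hpt : ∀ x : NInf, ∃ N : ℕ, ∀ n ≥ N, f n x = 0)
    (a : ℕ → NInf) (k : ℕ → ℕ)
    (hw : ∀ n : ℕ, k n ≥ n ∧ (∀ j < n, (a n).1 j = false) ∧ f (k n) (a n) ≠ 0) :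
    LPO := by
  intro b
  obtain ⟨N, hN⟩ := hpt (NInf.glue a b)
  rcases Decidable.em (∃ m, m < N ∧ b m = true) with ⟨m, -, hm⟩ | hno
  · exact Or.inr ⟨m, hm⟩
  · refine Or.inl fun n => Bool.eq_false_of_not_eq_true fun hn => ?_
    obtain ⟨m, hm, hmin⟩ := exists_first_true n hn
    have hNm : N ≤ m := Nat.le_of_not_lt fun hlt => hno ⟨m, hlt, hm⟩
    have hzero := hN (k m) (Nat.le_trans hNm (hw m).1)
    rw [NInf.glue_eq (fun n => (hw n).2.1) hm hmin] at hzero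
    exact (hw m).2.2 hzero
end

section
/- Assume FAN_{Π⁰₁}. Let (f_n) be a sequence of non-discontinuous functions from Cantor space 2^ℕ to ℝ, and let f : 2^ℕ → ℝ be non-discontinuous. If f_n → f semi-uniformly at every point of 2^ℕ, then f_n → f uniformly, i.e. for every ε > 0 there exists N such that |f_n(α) − f(α)| < ε for all n ≥ N and all α ∈ 2^ℕ. -/
open Filter

/-- The metric on Cantor space `ℕ → Bool`, with `dist α β = 2 ^ (-k)` where `k`
is the first index at which `α` and `β` differ. -/
noncomputable local instance : MetricSpace (ℕ → Bool) := PiNat.metricSpace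

/-- The initial segment of length `n` of a binary sequence. -/
def initSeg (α : ℕ → Bool) (n : ℕ) : List Bool := (List.range n).map α

/-- A bar on Cantor space. -/
def IsBar (B : Set (List Bool)) : Prop := ∀ α : ℕ → Bool, ∃ n : ℕ, initSeg α n ∈ B

/-- A `Π⁰₁`-bar: a bar given as the intersection of a decidable sequence of
sets of finite sequences, each closed under extension. -/
def IsPi01Bar (B : Set (List Bool)) : Prop :=
  IsBar B ∧ ∃ S : List Bool → ℕ → Bool,
    (∀ u : List Bool, u ∈ B ↔ ∀ n : ℕ, S u n = true) ∧
    (∀ u n, S u n = true → S (u ++ [false]) n = true ∧ S (u ++ [true]) n = true)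

/-- `FAN_{Π⁰₁}`: every `Π⁰₁`-bar is uniform. -/
def FanPi01 : Prop :=
  ∀ B : Set (List Bool), IsPi01Bar B → ∃ N : ℕ, ∀ α : ℕ → Bool, ∃ n ≤ N, initSeg α n ∈ B

/-- A function between metric spaces is non-discontinuous. -/
def NonDiscontinuous {X Y : Type*} [MetricSpace X] [MetricSpace Y] (h : X → Y) : Prop :=
  ¬ ∃ (x : X) (u : ℕ → X) (ε : ℝ), 0 < ε ∧ Tendsto u atTop (nhds x) ∧
      ∀ n : ℕ, dist (h (u n)) (h x) ≥ ε

/-- `f n → g` semi-uniformly at `x`. -/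
def SemiUniformAt {X Y : Type*} [MetricSpace X] [MetricSpace Y]
    (f : ℕ → X → Y) (g : X → Y) (x : X) : Prop :=
  ∀ ε : ℝ, 0 < ε → ∃ N : ℕ, ∃ δ : ℝ, 0 < δ ∧
    ∀ y : X, dist x y < δ → ∀ i ≥ N, dist (g y) (f i y) < ε

/-- The finite sequences `u` such that every term of index at least the length of `u` is
`ε`-close to the limit on the whole cylinder determined by `u`. -/
def uniformBar (f : ℕ → (ℕ → Bool) → ℝ) (g : (ℕ → Bool) → ℝ) (ε : ℝ) : Set (List Bool) :=
  {u | ∀ n, u.length ≤ n → ∀ β, initSeg β u.length = u → |f n β - g β| < ε}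

theorem length_initSeg (α : ℕ → Bool) (n : ℕ) : (initSeg α n).length = n := by
  simp [initSeg]

theorem initSeg_succ (α : ℕ → Bool) (n : ℕ) : initSeg α (n + 1) = initSeg α n ++ [α n] := by
  simp [initSeg, List.range_succ]

theorem initSeg_eq_of_append {α : ℕ → Bool} {u : List Bool} {b : Bool}
    (h : initSeg α (u ++ [b]).length = u ++ [b]) : initSeg α u.length = u := by
  rw [List.length_append, List.length_singleton, initSeg_succ] at h
  exact (List.append_inj h (length_initSeg α _)).1

theorem dist_le_of_initSeg_eq {α β : ℕ → Bool} {k : ℕ} (h : initSeg α k = initSeg β k) :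
    dist α β ≤ (1 / 2) ^ k := by
  refine PiNat.mem_cylinder_iff_dist_le.1 fun i hi => ?_
  exact List.map_inj_left.1 h i (List.mem_range.2 hi)

theorem isBar_uniformBar {f : ℕ → (ℕ → Bool) → ℝ} {g : (ℕ → Bool) → ℝ}
    (h : ∀ x : ℕ → Bool, SemiUniformAt f g x) {ε : ℝ} (hε : 0 < ε) :
    IsBar (uniformBar f g ε) := by
  intro α
  obtain ⟨N, δ, hδ, hN⟩ := h α ε hε
  obtain ⟨m, hm⟩ := exists_pow_lt_of_lt_one hδ (by norm_num : (1 / 2 : ℝ) < 1)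
  refine ⟨max N m, fun n hn β hβ => ?_⟩
  rw [length_initSeg] at hn hβ
  have hαβ : dist α β < δ := calc
    dist α β ≤ (1 / 2) ^ max N m := dist_le_of_initSeg_eq hβ.symm
    _ ≤ (1 / 2) ^ m :=
      pow_le_pow_of_le_one (by norm_num) (by norm_num) (le_max_right N m)
    _ < δ := hm
  rw [← Real.dist_eq, dist_comm]
  exact hN β hαβ n ((le_max_left N m).trans hn)

open Classical in
theorem isPi01Bar_uniformBar {f : ℕ → (ℕ → Bool) → ℝ} {g : (ℕ → Bool) → ℝ}
    (h : ∀ x : ℕ → Bool, SemiUniformAt f g x) {ε : ℝ} (hε : 0 < ε) :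
    IsPi01Bar (uniformBar f g ε) := by
  refine ⟨isBar_uniformBar h hε, fun u n =>
    decide (u.length ≤ n → ∀ β, initSeg β u.length = u → |f n β - g β| < ε), ?_, ?_⟩
  · intro u
    simp only [decide_eq_true_eq]
    rfl
  · intro u n hu
    simp only [decide_eq_true_eq] at hu ⊢
    have extend (b : Bool) (hn : (u ++ [b]).length ≤ n) (β : ℕ → Bool)
        (hβ : initSeg β (u ++ [b]).length = u ++ [b]) : |f n β - g β| < ε :=
      hu ((List.sublist_append_left u [b]).length_le.trans hn) β (initSeg_eq_of_append hβ)
    exact ⟨extend false, extend true⟩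

/-- Assuming `FAN_{Π⁰₁}`, semi-uniform convergence of non-discontinuous
functions on Cantor space implies uniform convergence. -/
theorem semiUniform_to_uniform_of_fan (hFan : FanPi01)
    (f : ℕ → (ℕ → Bool) → ℝ) (g : (ℕ → Bool) → ℝ)
    (hf : ∀ n, NonDiscontinuous (f n)) (hg : NonDiscontinuous g)
    (h : ∀ x : ℕ → Bool, SemiUniformAt f g x) :
    ∀ ε : ℝ, 0 < ε → ∃ N : ℕ, ∀ n ≥ N, ∀ α : ℕ → Bool, |f n α - g α| < ε := by
  intro ε hε
  obtain ⟨N, hN⟩ := hFan _ (isPi01Bar_uniformBar h hε)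
  refine ⟨N, fun n hn α => ?_⟩
  obtain ⟨m, hm, hα⟩ := hN α
  refine hα n ?_ α ?_
  · rw [length_initSeg]
    exact hm.trans hn
  · rw [length_initSeg]
end
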